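/- Let X be a 2×2 complex matrix with det X = 1, let η ∈ ℂ² be a unit vector, and let r be a real number such that X X† η = e^r η. Then X X† = cosh(r) · I + sinh(r) · (n¹ σ₁ + n² σ₂ + n³ σ₃), where nⁱ := ⟨η, σᵢ η⟩ (which is real for each i), I is the 2×2 identity matrix, and σ₁, σ₂, σ₃ are the Pauli matrices. -/

import Mathlib

open Matrix

/-- The Pauli matrices `σ₁, σ₂, σ₃`. -/
noncomputable def pauli : Fin 3 → Matrix (Fin 2) (Fin 2) ℂ
  | 0 => !![0, 1; 1, 0]
  | 1 => !![0, -Complex.I; Complex.I, 0]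
  | 2 => !![1, 0; 0, -1]

/-- A Hermitian `2 × 2` matrix of determinant `1` with unit eigenvector `η` and real eigenvalue
`e ≠ 0` is determined by `e` and `η`: its other eigenvalue is `f = e⁻¹`, on the orthogonal
complement of `η`. -/
theorem Matrix.IsHermitian.eq_of_mulVec_eq_smul_of_det_eq_one
    {M : Matrix (Fin 2) (Fin 2) ℂ} (hM : M.IsHermitian) (hdet : M.det = 1)
    {η : Fin 2 → ℂ} (hη : star η ⬝ᵥ η = 1) {e f : ℝ} (hef : (e : ℂ) * f = 1)
    (h : M *ᵥ η = (e : ℂ) • η) :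
    M = !![e * (η 0 * star (η 0)) + f * (η 1 * star (η 1)), (e - f) * (η 0 * star (η 1));
      (e - f) * (η 1 * star (η 0)), e * (η 1 * star (η 1)) + f * (η 0 * star (η 0))] := by
  have he : (e : ℂ) ≠ 0 := left_ne_zero_of_mul_eq_one hef
  have h0 := congrFun h 0
  have h1 := congrFun h 1
  simp only [mulVec, dotProduct, Fin.sum_univ_two, Pi.smul_apply, smul_eq_mul] at h0 h1
  have h0' := congrArg star h0
  have h1' := congrArg star h1
  simp only [star_add, star_mul', hM.apply, Complex.star_def, Complex.conj_ofReal] at h0' h1'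
  simp only [← Complex.star_def] at h0' h1'
  simp only [dotProduct, Fin.sum_univ_two, Pi.star_apply] at hη
  rw [det_fin_two] at hdet
  have k0 : M 0 0 * star (η 1) - M 0 1 * star (η 0) = f * star (η 1) := by
    apply mul_left_cancel₀ he
    linear_combination M 0 1 * h0' - M 0 0 * h1' + star (η 1) * hdet - star (η 1) * hef
  have k1 : M 1 1 * star (η 0) - M 1 0 * star (η 1) = f * star (η 0) := by
    apply mul_left_cancel₀ he
    linear_combination -M 1 1 * h0' + M 1 0 * h1' + star (η 0) * hdet - star (η 0) * hef
  ext i j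
  fin_cases i <;> fin_cases j <;> simp [-Complex.star_def, -RCLike.star_def]
  · linear_combination -M 0 0 * hη + star (η 0) * h0 + η 1 * k0
  · linear_combination -M 0 1 * hη + star (η 1) * h0 - η 0 * k0
  · linear_combination -M 1 0 * hη + star (η 0) * h1 - η 1 * k1
  · linear_combination -M 1 1 * hη + star (η 1) * h1 + η 0 * k1

theorem isHermitian_pauli (i : Fin 3) : (pauli i).IsHermitian := by
  ext j k
  fin_cases i <;> fin_cases j <;> fin_cases k <;> simp [pauli]

/-- If `det X = 1`, `η` is a unit vector and `X X† η = e^r η`, then the quantities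
`nⁱ = ⟨η, σᵢ η⟩` are real and
`X X† = cosh r · I + sinh r · (n¹σ₁ + n²σ₂ + n³σ₃)`. -/
theorem XXdagger_decomposition (X : Matrix (Fin 2) (Fin 2) ℂ) (hdet : X.det = 1)
    (η : Fin 2 → ℂ) (hη : star η ⬝ᵥ η = 1) (r : ℝ)
    (h : (X * Xᴴ) *ᵥ η = (Real.exp r : ℂ) • η) :
    (∀ i : Fin 3, (star η ⬝ᵥ (pauli i *ᵥ η)).im = 0) ∧
    X * Xᴴ = (Real.cosh r : ℂ) • (1 : Matrix (Fin 2) (Fin 2) ℂ)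
        + (Real.sinh r : ℂ) •
            ((star η ⬝ᵥ (pauli 0 *ᵥ η)) • pauli 0
              + (star η ⬝ᵥ (pauli 1 *ᵥ η)) • pauli 1
              + (star η ⬝ᵥ (pauli 2 *ᵥ η)) • pauli 2) := by
  refine ⟨fun i => (isHermitian_pauli i).im_star_dotProduct_mulVec_self η, ?_⟩
  have hef : (Real.exp r : ℂ) * Real.exp (-r) = 1 := by
    rw [← Complex.ofReal_mul, ← Real.exp_add, add_neg_cancel, Real.exp_zero, Complex.ofReal_one]
  have hXdet : (X * Xᴴ).det = 1 := by simp [det_conjTranspose, hdet]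
  rw [(isHermitian_mul_conjTranspose_self X).eq_of_mulVec_eq_smul_of_det_eq_one hXdet hη hef h]
  simp only [dotProduct, Fin.sum_univ_two, Pi.star_apply] at hη
  rw [Real.cosh_eq, Real.sinh_eq]
  push_cast
  ext i j
  fin_cases i <;> fin_cases j <;>
    simp [-Complex.star_def, -RCLike.star_def, pauli, dotProduct, mulVec, Fin.sum_univ_two]
  · linear_combination (Complex.exp r + Complex.exp (-r)) / 2 * hη
  · ring_nf
    simp only [Complex.I_sq]
    ring
  · ring_nf
    simp only [Complex.I_sq]
    ring
  · linear_combination (Complex.exp r + Complex.exp (-r)) / 2 * hη
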